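/- (Rakhmanov's lemma.) Let μ be a nontrivial probability measure on the unit circle with Verblunsky coefficients α_n. If limsup_{n→∞} |α_n| = 1, then μ is singular with respect to normalized Lebesgue measure dθ/2π on ∂𝔻. -/

import Mathlib

open MeasureTheory Polynomial Filter

noncomputable section

/-- A nontrivial probability measure on the unit circle: a probability measure on `ℂ`
supported on `{z : ‖z‖ = 1}` that is not concentrated on any finite set
(equivalently, its support is infinite). -/
structure IsNontrivialOnCircle (μ : Measure ℂ) : Prop where
  prob : IsProbabilityMeasure μ
  onCircle : μ {z : ℂ | ‖z‖ = 1}ᶜ = 0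
  infiniteSupport : ∀ s : Finset ℂ, μ ((↑s : Set ℂ)ᶜ) ≠ 0

/-- `Φ` is the family of monic orthogonal polynomials for `μ`: each `Φ n` is monic of
degree `n` and orthogonal in `L²(∂𝔻, dμ)` to `z^j` for `j = 0, …, n-1`. -/
def IsMonicOPUC (μ : Measure ℂ) (Φ : ℕ → Polynomial ℂ) : Prop :=
  ∀ n : ℕ, ((Φ n).Monic ∧ (Φ n).natDegree = n) ∧
    ∀ j < n, ∫ z, (starRingEnd ℂ) z ^ j * (Φ n).eval z ∂μ = 0

/-- Verblunsky coefficients: `α n = -conj (Φ (n+1) (0))`. -/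
def verblunsky (Φ : ℕ → Polynomial ℂ) (n : ℕ) : ℂ :=
  - (starRingEnd ℂ) ((Φ (n + 1)).eval 0)

/-- Squared `L²(dμ)` norm of a polynomial. -/
def polyNormSq (μ : Measure ℂ) (P : Polynomial ℂ) : ℝ :=
  ∫ z, ‖P.eval z‖ ^ 2 ∂μ

/-- Orthonormal polynomial: `φ = Φ / ‖Φ‖_{L²(dμ)}`. -/
def orthonormalize (μ : Measure ℂ) (P : Polynomial ℂ) : Polynomial ℂ :=
  Polynomial.C ((Real.sqrt (polyNormSq μ P) : ℂ))⁻¹ * P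

/-- The reversed polynomial `P^{*,n}(z) = z^n conj (P (1/conj z))`. -/
def revStar (n : ℕ) (P : Polynomial ℂ) : Polynomial ℂ :=
  ∑ j ∈ Finset.range (n + 1),
    Polynomial.C ((starRingEnd ℂ) (P.coeff (n - j))) * Polynomial.X ^ j

/-- Normalized Lebesgue (arc-length) measure `dθ/2π` on the unit circle, as a measure on `ℂ`. -/
def lebCircle : Measure ℂ :=
  (ENNReal.ofReal (2 * Real.pi))⁻¹ •
    Measure.map (fun θ : ℝ => Complex.exp (Complex.I * θ))
      (volume.restrict (Set.Ioc 0 (2 * Real.pi)))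

open ComplexConjugate

section Circle

theorem conj_mul_self_of_norm_eq_one {z : ℂ} (hz : ‖z‖ = 1) : conj z * z = 1 := by
  rw [Complex.conj_mul', hz]; norm_num

theorem ContinuousOn.integrable_of_circle {E : Type*} [NormedAddCommGroup E]
    {ν : Measure ℂ} [IsFiniteMeasure ν]
    (hν : ∀ᵐ z ∂ν, ‖z‖ = 1) {f : ℂ → E} (hf : ContinuousOn f (Metric.sphere 0 1)) :
    Integrable f ν := by
  have h := hf.integrableOn_compact (μ := ν) (isCompact_sphere (0 : ℂ) 1)
  rwa [IntegrableOn, Measure.restrict_eq_self_of_ae_mem] at h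
  simpa using hν

theorem isProbabilityMeasure_lebCircle : IsProbabilityMeasure lebCircle := by
  have h : (0 : ℝ) < 2 * Real.pi := by positivity
  constructor
  rw [lebCircle, Measure.smul_apply, Measure.map_apply (by fun_prop) MeasurableSet.univ]
  simp only [Set.preimage_univ, Measure.restrict_apply_univ, Real.volume_Ioc, sub_zero,
    smul_eq_mul]
  exact ENNReal.inv_mul_cancel (by simpa using h) ENNReal.ofReal_ne_top

theorem ae_norm_eq_one_lebCircle : ∀ᵐ z ∂lebCircle, ‖z‖ = 1 := by
  refine Measure.ae_smul_measure ?_ _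
  rw [ae_map_iff (by fun_prop) (measurableSet_eq_fun (by fun_prop) (by fun_prop))]
  refine Eventually.of_forall fun θ => ?_
  rw [mul_comm, Complex.norm_exp_ofReal_mul_I]

theorem integral_lebCircle {f : ℂ → ℂ} (hf : ContinuousOn f (Metric.sphere 0 1)) :
    ∫ z, f z ∂lebCircle = Real.circleAverage f 0 1 := by
  have h : (0 : ℝ) ≤ 2 * Real.pi := by positivity
  have hmeas : AEStronglyMeasurable f lebCircle :=
    have := isProbabilityMeasure_lebCircle
    (hf.integrable_of_circle ae_norm_eq_one_lebCircle).aestronglyMeasurable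
  have hne : (ENNReal.ofReal (2 * Real.pi))⁻¹ ≠ 0 :=
    ENNReal.inv_ne_zero.2 ENNReal.ofReal_ne_top
  rw [lebCircle] at hmeas ⊢
  rw [integral_smul_measure, integral_map (by fun_prop), Real.circleAverage,
    intervalIntegral.integral_of_le h, ENNReal.toReal_inv, ENNReal.toReal_ofReal h]
  · simp [circleMap, mul_comm]
  · exact hmeas.mono_ac (Measure.absolutelyContinuous_smul hne)

theorem integral_lebCircle_of_differentiableOn {f : ℂ → ℂ}
    (hf : ∀ z, ‖z‖ ≤ 1 → DifferentiableAt ℂ f z) : ∫ z, f z ∂lebCircle = f 0 := by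
  rw [integral_lebCircle fun z hz =>
    (hf z (mem_sphere_zero_iff_norm.1 hz).le).continuousAt.continuousWithinAt]
  refine DiffContOnCl.circleAverage (DifferentiableOn.diffContOnCl fun z hz => ?_)
  rw [abs_one, closure_ball _ one_ne_zero, mem_closedBall_zero_iff] at hz
  exact (hf z hz).differentiableWithinAt

/-- A Kolmogorov-type bound: an analytic function with positive real part taking the value `1` at
the origin has square root of its modulus integrable over the circle, with a universal bound. -/
theorem integral_sqrt_norm_le_two {F : ℂ → ℂ} (hF : ∀ z, ‖z‖ ≤ 1 → DifferentiableAt ℂ F z)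
    (hre : ∀ z, ‖z‖ ≤ 1 → 0 < (F z).re) (h0 : F 0 = 1) :
    ∫ z, ‖F z‖ ^ (1 / 2 : ℝ) ∂lebCircle ≤ 2 := by
  have := isProbabilityMeasure_lebCircle
  have hG : ∀ z, ‖z‖ ≤ 1 → DifferentiableAt ℂ (fun z => F z ^ ((1 / 2 : ℝ) : ℂ)) z :=
    fun z hz => (hF z hz).cpow (differentiableAt_const _) (Or.inl (hre z hz))
  have hGi : Integrable (fun z => F z ^ ((1 / 2 : ℝ) : ℂ)) lebCircle :=
    ContinuousOn.integrable_of_circle ae_norm_eq_one_lebCircle fun z hz =>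
      (hG z (mem_sphere_zero_iff_norm.1 hz).le).continuousAt.continuousWithinAt
  have hint : ∫ z, (F z ^ ((1 / 2 : ℝ) : ℂ)).re ∂lebCircle = 1 := by
    have h := integral_lebCircle_of_differentiableOn hG
    rw [h0, Complex.one_cpow] at h
    have h2 := integral_re hGi
    rw [h] at h2
    simpa using h2
  calc ∫ z, ‖F z‖ ^ (1 / 2 : ℝ) ∂lebCircle
      ≤ ∫ z, 2 * (F z ^ ((1 / 2 : ℝ) : ℂ)).re ∂lebCircle := by
        refine integral_mono_of_nonneg (Eventually.of_forall fun z => by positivity)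
          (hGi.re.const_mul 2) ?_
        filter_upwards [ae_norm_eq_one_lebCircle] with z hz
        rw [Complex.cpow_ofReal_re]
        have harg := Complex.abs_arg_le_pi_div_two_iff.2 (hre z hz.le).le
        have hcos : 1 / 2 ≤ Real.cos (Complex.arg (F z) * (1 / 2)) := by
          rw [← Real.cos_abs (_ * _), abs_mul, abs_of_pos (by norm_num : (0 : ℝ) < 1 / 2)]
          have hpi := Real.pi_pos
          refine Real.cos_pi_div_three.symm.trans_le ?_
          apply Real.cos_le_cos_of_nonneg_of_le_pi <;> first | positivity | linarith
        have : 0 ≤ ‖F z‖ ^ (1 / 2 : ℝ) := by positivity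
        nlinarith
    _ = 2 := by rw [integral_const_mul, hint, mul_one]

end Circle

section RevStar

theorem natDegree_revStar_le (n : ℕ) (P : Polynomial ℂ) : (revStar n P).natDegree ≤ n := by
  refine natDegree_sum_le_of_forall_le _ _ fun j hj => ?_
  exact (natDegree_C_mul_X_pow_le _ _).trans (Finset.mem_range_succ_iff.1 hj)

theorem eval_zero_revStar (n : ℕ) (P : Polynomial ℂ) :
    (revStar n P).eval 0 = conj (P.coeff n) := by
  simp [revStar, eval_finsetSum, Finset.sum_range_succ']

theorem eval_revStar {n : ℕ} {P : Polynomial ℂ} (hP : P.natDegree ≤ n) {z : ℂ} (hz : ‖z‖ = 1) :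
    (revStar n P).eval z = z ^ n * conj (P.eval z) := by
  rw [eval_eq_sum_range' (Nat.lt_succ_of_le hP), map_sum, Finset.mul_sum, revStar,
    eval_finsetSum, ← Finset.sum_range_reflect]
  refine Finset.sum_congr rfl fun j hj => ?_
  have hj' : j ≤ n := Finset.mem_range_succ_iff.1 hj
  have h1 : n + 1 - 1 - j = n - j := by lia
  have h2 : n - (n - j) = j := by lia
  rw [h1, h2, map_mul, map_pow]
  obtain ⟨k, rfl⟩ := Nat.exists_eq_add_of_le hj'
  have h3 : conj z ^ j * z ^ j = 1 := by
    rw [← mul_pow, conj_mul_self_of_norm_eq_one hz, one_pow]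
  simp only [eval_mul, eval_C, eval_pow, eval_X, add_tsub_cancel_left, pow_add]
  linear_combination -conj (P.coeff j) * z ^ k * h3

theorem norm_eval_revStar {n : ℕ} {P : Polynomial ℂ} (hP : P.natDegree ≤ n) {z : ℂ}
    (hz : ‖z‖ = 1) : ‖(revStar n P).eval z‖ = ‖P.eval z‖ := by
  simp [eval_revStar hP hz, hz]

end RevStar

namespace IsNontrivialOnCircle

variable {μ : Measure ℂ}

theorem ae_norm_eq_one (hμ : IsNontrivialOnCircle μ) : ∀ᵐ z ∂μ, ‖z‖ = 1 := hμ.onCircle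

theorem integrable (hμ : IsNontrivialOnCircle μ) {E : Type*} [NormedAddCommGroup E] {f : ℂ → E}
    (hf : Continuous f) : Integrable f μ :=
  have := hμ.prob
  hf.continuousOn.integrable_of_circle hμ.ae_norm_eq_one

theorem eq_zero_of_ae_eval_eq_zero (hμ : IsNontrivialOnCircle μ) {P : Polynomial ℂ}
    (h : ∀ᵐ z ∂μ, P.eval z = 0) : P = 0 := by
  by_contra hP
  refine hμ.infiniteSupport P.roots.toFinset (measure_mono_null (fun z hz => ?_) h)
  simpa [hP] using hz

theorem polyNormSq_pos (hμ : IsNontrivialOnCircle μ) {P : Polynomial ℂ} (hP : P ≠ 0) :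
    0 < polyNormSq μ P := by
  have hnn : 0 ≤ fun z : ℂ => ‖P.eval z‖ ^ 2 := fun z => by positivity
  refine (integral_nonneg hnn).lt_of_ne' fun h => hP (hμ.eq_zero_of_ae_eval_eq_zero ?_)
  rw [integral_eq_zero_iff_of_nonneg hnn (hμ.integrable (by fun_prop))] at h
  filter_upwards [h] with z hz
  simpa using hz

end IsNontrivialOnCircle

namespace IsMonicOPUC

variable {μ : Measure ℂ} {Φ : ℕ → Polynomial ℂ}

theorem natDegree_eq (hΦ : IsMonicOPUC μ Φ) (n : ℕ) : (Φ n).natDegree = n := (hΦ n).1.2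

theorem ne_zero (hΦ : IsMonicOPUC μ Φ) (n : ℕ) : Φ n ≠ 0 := (hΦ n).1.1.ne_zero

theorem eval_zero_revStar (hΦ : IsMonicOPUC μ Φ) (n : ℕ) : (revStar n (Φ n)).eval 0 = 1 := by
  have h := (hΦ n).1.1.coeff_natDegree
  rw [hΦ.natDegree_eq] at h
  rw [_root_.eval_zero_revStar, h, map_one]

theorem integral_conj_mul_revStar (hμ : IsNontrivialOnCircle μ) (hΦ : IsMonicOPUC μ Φ) {n j : ℕ}
    (hj : 0 < j) (hjn : j ≤ n) : ∫ z, conj z ^ j * (revStar n (Φ n)).eval z ∂μ = 0 := by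
  rw [← map_zero conj, ← (hΦ n).2 (n - j) (by lia), ← integral_conj]
  refine integral_congr_ae ?_
  filter_upwards [hμ.ae_norm_eq_one] with z hz
  obtain ⟨k, rfl⟩ := Nat.exists_eq_add_of_le hjn
  have h3 : conj z ^ j * z ^ j = 1 := by
    rw [← mul_pow, conj_mul_self_of_norm_eq_one hz, one_pow]
  rw [eval_revStar (hΦ.natDegree_eq _).le hz]
  simp only [map_mul, map_pow, Complex.conj_conj, add_tsub_cancel_left, pow_add]
  linear_combination conj ((Φ (j + k)).eval z) * z ^ k * h3

theorem integral_conj_eval_mul (hμ : IsNontrivialOnCircle μ) {P Q : Polynomial ℂ} {n : ℕ}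
    (hP : P.natDegree ≤ n) (h : ∀ j ≤ n, P.coeff j ≠ 0 → ∫ z, conj z ^ j * Q.eval z ∂μ = 0) :
    ∫ z, conj (P.eval z) * Q.eval z ∂μ = 0 := by
  have : ∀ z, conj (P.eval z) * Q.eval z =
      ∑ j ∈ Finset.range (n + 1), conj (P.coeff j) * (conj z ^ j * Q.eval z) := fun z => by
    rw [eval_eq_sum_range' (Nat.lt_succ_of_le hP), map_sum, Finset.sum_mul]
    simp [mul_assoc]
  simp_rw [this]
  rw [integral_finsetSum _ fun j _ => hμ.integrable (by fun_prop)]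
  refine Finset.sum_eq_zero fun j hj => ?_
  rw [integral_const_mul]
  by_cases hc : P.coeff j = 0
  · simp [hc]
  · rw [h j (Finset.mem_range_succ_iff.1 hj) hc, mul_zero]

theorem eval_zero_succ (n : ℕ) : (Φ (n + 1)).eval 0 = -conj (verblunsky Φ n) := by
  simp [verblunsky]

/-- The Szegő recursion. -/
theorem szego (hμ : IsNontrivialOnCircle μ) (hΦ : IsMonicOPUC μ Φ) (n : ℕ) :
    Φ (n + 1) = X * Φ n - C (conj (verblunsky Φ n)) * revStar n (Φ n) := by
  set a := verblunsky Φ n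
  set D := Φ (n + 1) - X * Φ n + C (conj a) * revStar n (Φ n) with hD
  suffices D = 0 by linear_combination this
  have hdeg : D.natDegree ≤ n := by
    have h2 : (C (conj a) * revStar n (Φ n)).natDegree ≤ n :=
      (natDegree_C_mul_le _ _).trans (natDegree_revStar_le _ _)
    have hX : (X * Φ n).Monic := monic_X.mul (hΦ n).1.1
    have h1 : (Φ (n + 1) - X * Φ n).natDegree ≤ n := by
      have hdX : (X * Φ n).natDegree = n + 1 := by
        rw [natDegree_X_mul (hΦ.ne_zero n), hΦ.natDegree_eq]
      refine Nat.le_of_lt_succ (Nat.lt_of_le_of_ne ?_ ?_)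
      · exact (natDegree_sub_le _ _).trans (by simp [hdX, hΦ.natDegree_eq])
      · intro he
        have hc1 := (hΦ (n + 1)).1.1.coeff_natDegree
        have hc2 := hX.coeff_natDegree
        rw [hΦ.natDegree_eq] at hc1
        rw [hdX] at hc2
        have h0 : (Φ (n + 1) - X * Φ n).coeff (n + 1) = 0 := by rw [coeff_sub, hc1, hc2, sub_self]
        have hlead : (Φ (n + 1) - X * Φ n).leadingCoeff = 0 := by rwa [leadingCoeff, he]
        rw [leadingCoeff_eq_zero] at hlead
        rw [hlead] at he
        simp at he
    exact (natDegree_add_le _ _).trans (max_le h1 h2)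
  have hzero : D.coeff 0 = 0 := by
    rw [coeff_zero_eq_eval_zero]
    simp only [hD, eval_add, eval_sub, eval_mul, eval_X, eval_C, hΦ.eval_zero_revStar,
      eval_zero_succ, a]
    ring
  have hself : ∫ z, conj (D.eval z) * D.eval z ∂μ = 0 := by
    refine integral_conj_eval_mul hμ hdeg fun j hj hc => ?_
    have hj0 : 0 < j := Nat.pos_of_ne_zero fun h => hc (h ▸ hzero)
    have hsplit : ∀ᵐ z ∂μ, conj z ^ j * D.eval z = conj z ^ j * (Φ (n + 1)).eval z
        - conj z ^ (j - 1) * (Φ n).eval z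
        + conj a * (conj z ^ j * (revStar n (Φ n)).eval z) := by
      filter_upwards [hμ.ae_norm_eq_one] with z hz
      obtain ⟨k, rfl⟩ := Nat.exists_eq_add_of_le' hj0
      simp only [hD, eval_add, eval_sub, eval_mul, eval_X, eval_C, pow_succ, Nat.add_sub_cancel]
      linear_combination -conj z ^ k * (Φ n).eval z * conj_mul_self_of_norm_eq_one hz
    rw [integral_congr_ae hsplit, integral_add (hμ.integrable (by fun_prop))
      (hμ.integrable (by fun_prop)), integral_sub (hμ.integrable (by fun_prop))
      (hμ.integrable (by fun_prop)), integral_const_mul, (hΦ (n + 1)).2 j (by lia),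
      (hΦ n).2 (j - 1) (by lia), hΦ.integral_conj_mul_revStar hμ hj0 hj]
    simp
  have hN : polyNormSq μ D = 0 := by
    simp_rw [Complex.conj_mul'] at hself
    unfold polyNormSq
    exact_mod_cast hself
  by_contra hne
  exact (hμ.polyNormSq_pos hne).ne' hN

theorem revStar_succ (hμ : IsNontrivialOnCircle μ) (hΦ : IsMonicOPUC μ Φ) (n : ℕ) :
    revStar (n + 1) (Φ (n + 1)) = revStar n (Φ n) - C (verblunsky Φ n) * X * Φ n := by
  refine sub_eq_zero.1 (hμ.eq_zero_of_ae_eval_eq_zero ?_)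
  filter_upwards [hμ.ae_norm_eq_one] with z hz
  have h1 := conj_mul_self_of_norm_eq_one hz
  have h2 : conj z ^ n * z ^ n = 1 := by rw [← mul_pow, h1, one_pow]
  rw [eval_sub, eval_revStar (hΦ.natDegree_eq _).le hz, hΦ.szego hμ]
  simp only [eval_sub, eval_mul, eval_C, eval_X, eval_revStar (hΦ.natDegree_eq n).le hz, map_sub,
    map_mul, map_pow, Complex.conj_conj, pow_succ]
  linear_combination z ^ n * conj ((Φ n).eval z) * h1 - z * verblunsky Φ n * (Φ n).eval z * h2

theorem polyNormSq_succ (hμ : IsNontrivialOnCircle μ) (hΦ : IsMonicOPUC μ Φ) (n : ℕ) :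
    polyNormSq μ (Φ (n + 1)) = (1 - ‖verblunsky Φ n‖ ^ 2) * polyNormSq μ (Φ n) := by
  set a := verblunsky Φ n
  have hcross : ∫ z, conj ((revStar n (Φ n)).eval z) * (Φ (n + 1)).eval z ∂μ = 0 :=
    integral_conj_eval_mul hμ (natDegree_revStar_le _ _) fun j hj _ =>
      (hΦ (n + 1)).2 j (by lia)
  have hpt : ∀ᵐ z ∂μ, ((‖(Φ n).eval z‖ ^ 2 : ℝ)) = ‖(Φ (n + 1)).eval z‖ ^ 2
      + ‖a‖ ^ 2 * ‖(Φ n).eval z‖ ^ 2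
      + 2 * (a * (conj ((revStar n (Φ n)).eval z) * (Φ (n + 1)).eval z)).re := by
    filter_upwards [hμ.ae_norm_eq_one] with z hz
    have h : z * (Φ n).eval z = (Φ (n + 1)).eval z + conj a * (revStar n (Φ n)).eval z := by
      rw [hΦ.szego hμ]; simp [a]
    have hn : ‖(Φ n).eval z‖ = ‖z * (Φ n).eval z‖ := by rw [norm_mul, hz, one_mul]
    conv_lhs => rw [hn, h]
    rw [← norm_eval_revStar (hΦ.natDegree_eq n).le hz]
    simp only [← Complex.normSq_eq_norm_sq, Complex.normSq_apply, Complex.add_re, Complex.add_im,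
      Complex.mul_re, Complex.mul_im, Complex.conj_re, Complex.conj_im]
    ring
  have hint : ∫ z, (a * (conj ((revStar n (Φ n)).eval z) * (Φ (n + 1)).eval z)).re ∂μ = 0 := by
    have h := integral_re (hμ.integrable (f := fun z =>
      a * (conj ((revStar n (Φ n)).eval z) * (Φ (n + 1)).eval z)) (by fun_prop))
    rw [integral_const_mul, hcross] at h
    simpa using h
  have h := integral_congr_ae hpt
  rw [integral_add (hμ.integrable (by fun_prop)) (hμ.integrable (by fun_prop)),
    integral_add (hμ.integrable (by fun_prop)) (hμ.integrable (by fun_prop)),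
    integral_const_mul, integral_const_mul, hint] at h
  unfold polyNormSq
  linarith

theorem norm_verblunsky_lt_one (hμ : IsNontrivialOnCircle μ) (hΦ : IsMonicOPUC μ Φ) (n : ℕ) :
    ‖verblunsky Φ n‖ < 1 := by
  have h := hΦ.polyNormSq_succ hμ n
  have h1 := hμ.polyNormSq_pos (hΦ.ne_zero (n + 1))
  have h2 := hμ.polyNormSq_pos (hΦ.ne_zero n)
  rw [h] at h1
  have h3 := pos_of_mul_pos_left h1 h2.le
  nlinarith [norm_nonneg (verblunsky Φ n)]

/-- In the closed disc the reversed polynomials dominate the orthogonal ones and have no zeros. -/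
theorem norm_eval_le_norm_eval_revStar (hμ : IsNontrivialOnCircle μ) (hΦ : IsMonicOPUC μ Φ) {z : ℂ}
    (hz : ‖z‖ ≤ 1) (n : ℕ) : ‖(Φ n).eval z‖ ≤ ‖(revStar n (Φ n)).eval z‖ ∧
      0 < ‖(revStar n (Φ n)).eval z‖ := by
  induction n with
  | zero =>
    have h : Φ 0 = 1 := (hΦ 0).1.1.natDegree_eq_zero.1 (hΦ 0).1.2
    simp [h, revStar]
  | succ n ih =>
    obtain ⟨h1, h2⟩ := ih
    have ha := hΦ.norm_verblunsky_lt_one hμ n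
    rw [hΦ.revStar_succ hμ, hΦ.szego hμ]
    set a := verblunsky Φ n
    set S := (revStar n (Φ n)).eval z with hS
    set P := (Φ n).eval z with hP
    have hzP : ‖z * P‖ ≤ ‖S‖ := by
      rw [norm_mul]
      exact (mul_le_of_le_one_left (norm_nonneg _) hz).trans h1
    simp only [eval_sub, eval_mul, eval_C, eval_X, ← hS, ← hP]
    constructor
    · have hid : ‖S - a * z * P‖ ^ 2 - ‖z * P - conj a * S‖ ^ 2
          = (1 - ‖a‖ ^ 2) * (‖S‖ ^ 2 - ‖z * P‖ ^ 2) := by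
        simp only [← Complex.normSq_eq_norm_sq, Complex.normSq_apply, Complex.sub_re,
          Complex.sub_im, Complex.mul_re, Complex.mul_im, Complex.conj_re, Complex.conj_im]
        ring
      have hp1 : 0 ≤ 1 - ‖a‖ ^ 2 := by nlinarith [norm_nonneg a]
      have hp2 : 0 ≤ ‖S‖ ^ 2 - ‖z * P‖ ^ 2 := by nlinarith [norm_nonneg (z * P)]
      have := mul_nonneg hp1 hp2
      exact le_of_sq_le_sq (by linarith) (norm_nonneg _)
    · have h3 : ‖a * z * P‖ < ‖S‖ := by
        rw [mul_assoc, norm_mul]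
        nlinarith [norm_nonneg a, norm_nonneg (z * P)]
      have := norm_sub_norm_le S (a * z * P)
      linarith

theorem eval_revStar_ne_zero (hμ : IsNontrivialOnCircle μ) (hΦ : IsMonicOPUC μ Φ) {z : ℂ}
    (hz : ‖z‖ ≤ 1) (n : ℕ) : (revStar n (Φ n)).eval z ≠ 0 :=
  norm_pos_iff.1 (hΦ.norm_eval_le_norm_eval_revStar hμ hz n).2

theorem integrable_inv_sq_norm_revStar (hμ : IsNontrivialOnCircle μ) (hΦ : IsMonicOPUC μ Φ)
    (n : ℕ) : Integrable (fun z => (‖(revStar n (Φ n)).eval z‖ ^ 2)⁻¹) lebCircle := by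
  have := isProbabilityMeasure_lebCircle
  refine ContinuousOn.integrable_of_circle ae_norm_eq_one_lebCircle
    (ContinuousOn.inv₀ (by fun_prop) fun z hz => ?_)
  have := hΦ.eval_revStar_ne_zero hμ (mem_sphere_zero_iff_norm.1 hz).le n
  positivity

/-- The Bernstein–Szegő weights `‖Φ n‖² / |Φ n|²` have total mass one. -/
theorem polyNormSq_mul_integral_inv_sq_norm (hμ : IsNontrivialOnCircle μ) (hΦ : IsMonicOPUC μ Φ)
    (n : ℕ) : polyNormSq μ (Φ n) *
      ∫ z, (‖(revStar n (Φ n)).eval z‖ ^ 2)⁻¹ ∂lebCircle = 1 := by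
  have := isProbabilityMeasure_lebCircle
  induction n with
  | zero =>
    have := hμ.prob
    have h : Φ 0 = 1 := (hΦ 0).1.1.natDegree_eq_zero.1 (hΦ 0).1.2
    simp [h, revStar, polyNormSq]
  | succ n ih =>
    set a := verblunsky Φ n with ha
    have hd : ∀ z, ‖z‖ ≤ 1 → DifferentiableAt ℂ (fun z => a * z ^ (n + 1) /
        ((revStar n (Φ n)).eval z * (revStar (n + 1) (Φ (n + 1))).eval z)) z := fun z hz => by
      refine DifferentiableAt.div (by fun_prop) ?_ (mul_ne_zero
        (hΦ.eval_revStar_ne_zero hμ hz n) (hΦ.eval_revStar_ne_zero hμ hz (n + 1)))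
      exact (Polynomial.differentiableAt _).mul (Polynomial.differentiableAt _)
    have hi : Integrable (fun z => a * z ^ (n + 1) /
        ((revStar n (Φ n)).eval z * (revStar (n + 1) (Φ (n + 1))).eval z)) lebCircle :=
      ContinuousOn.integrable_of_circle ae_norm_eq_one_lebCircle fun z hz =>
        (hd z (mem_sphere_zero_iff_norm.1 hz).le).continuousAt.continuousWithinAt
    have hre : ∫ z, (a * z ^ (n + 1) / ((revStar n (Φ n)).eval z *
        (revStar (n + 1) (Φ (n + 1))).eval z)).re ∂lebCircle = _ := integral_re hi
    rw [integral_lebCircle_of_differentiableOn hd] at hre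
    simp only [ne_eq, Nat.add_eq_zero_iff, one_ne_zero, and_false, not_false_eq_true, zero_pow,
      mul_zero, zero_div, map_zero] at hre
    have hpt : ∀ᵐ z ∂lebCircle, (1 - ‖a‖ ^ 2) *
        (‖(revStar (n + 1) (Φ (n + 1))).eval z‖ ^ 2)⁻¹ =
        (‖(revStar n (Φ n)).eval z‖ ^ 2)⁻¹ + 2 * (a * z ^ (n + 1) /
        ((revStar n (Φ n)).eval z * (revStar (n + 1) (Φ (n + 1))).eval z)).re := by
      filter_upwards [ae_norm_eq_one_lebCircle] with z hz
      have hS := hΦ.eval_revStar_ne_zero hμ hz.le n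
      have hT := hΦ.eval_revStar_ne_zero hμ hz.le (n + 1)
      have hP : (Φ n).eval z = z ^ n * conj ((revStar n (Φ n)).eval z) := by
        rw [eval_revStar (hΦ.natDegree_eq n).le hz, map_mul, map_pow, ← mul_assoc, ← mul_pow,
          mul_comm z, conj_mul_self_of_norm_eq_one hz, one_pow, one_mul, Complex.conj_conj]
      have hnorm := norm_eval_revStar (hΦ.natDegree_eq n).le hz
      have hTS : (revStar (n + 1) (Φ (n + 1))).eval z =
          (revStar n (Φ n)).eval z - a * z * (Φ n).eval z := by
        rw [hΦ.revStar_succ hμ]; simp [ha]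
      set S := (revStar n (Φ n)).eval z
      set T := (revStar (n + 1) (Φ (n + 1))).eval z
      set P := (Φ n).eval z
      have hq : a * z ^ (n + 1) / (S * T) =
          (a * z * P * conj T) * ((‖S‖ ^ 2)⁻¹ * (‖T‖ ^ 2)⁻¹ : ℝ) := by
        have hcS : conj S ≠ 0 := (_root_.map_ne_zero _).2 hS
        have hcT : conj T ≠ 0 := (_root_.map_ne_zero _).2 hT
        push_cast
        rw [← Complex.conj_mul', ← Complex.conj_mul', hP]
        field_simp
        ring
      have hz2 : ‖z * P‖ ^ 2 = ‖S‖ ^ 2 := by rw [norm_mul, hz, one_mul, hnorm]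
      have hid : (1 - ‖a‖ ^ 2) * ‖S‖ ^ 2 = ‖T‖ ^ 2 + 2 * (a * z * P * conj T).re := by
        have h1 : ‖T‖ ^ 2 + 2 * (a * z * P * conj T).re = ‖S‖ ^ 2 - ‖a‖ ^ 2 * ‖z * P‖ ^ 2 := by
          rw [hTS]
          simp only [← Complex.normSq_eq_norm_sq, Complex.normSq_apply, Complex.sub_re,
            Complex.sub_im, Complex.mul_re, Complex.mul_im, Complex.conj_re, Complex.conj_im]
          ring
        rw [h1, hz2]
        ring
      rw [hq, Complex.re_mul_ofReal]
      have hS' : ‖S‖ ≠ 0 := norm_ne_zero_iff.2 hS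
      have hT' : ‖T‖ ≠ 0 := norm_ne_zero_iff.2 hT
      field_simp
      linear_combination hid
    have hint := integral_congr_ae hpt
    rw [integral_const_mul, integral_add (hΦ.integrable_inv_sq_norm_revStar hμ n)
      (by exact hi.re.const_mul 2), integral_const_mul] at hint
    rw [hre, mul_zero, add_zero] at hint
    rw [hΦ.polyNormSq_succ hμ, mul_right_comm, hint, mul_comm, ih]

theorem integral_sqrt_norm_div_le_two (hμ : IsNontrivialOnCircle μ) (hΦ : IsMonicOPUC μ Φ)
    (n : ℕ) : ∫ z, ‖(revStar n (Φ n)).eval z / (revStar (n + 1) (Φ (n + 1))).eval z‖ ^ (1 / 2 : ℝ)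
      ∂lebCircle ≤ 2 := by
  refine integral_sqrt_norm_le_two (F := fun z => (revStar n (Φ n)).eval z /
    (revStar (n + 1) (Φ (n + 1))).eval z) (fun z hz => ?_) (fun z hz => ?_) ?_
  · exact (Polynomial.differentiableAt _).div (Polynomial.differentiableAt _)
      (hΦ.eval_revStar_ne_zero hμ hz _)
  · have hT := hΦ.eval_revStar_ne_zero hμ hz (n + 1)
    obtain ⟨h1, h2⟩ := hΦ.norm_eval_le_norm_eval_revStar hμ hz n
    have ha := hΦ.norm_verblunsky_lt_one hμ n
    have hTS : (revStar (n + 1) (Φ (n + 1))).eval z =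
        (revStar n (Φ n)).eval z - verblunsky Φ n * z * (Φ n).eval z := by
      rw [hΦ.revStar_succ hμ]; simp
    set S := (revStar n (Φ n)).eval z
    set T := (revStar (n + 1) (Φ (n + 1))).eval z
    set u := verblunsky Φ n * z * (Φ n).eval z with hu
    have hlt : ‖u‖ < ‖S‖ := by
      rw [hu, norm_mul, norm_mul]
      calc _ ≤ ‖verblunsky Φ n‖ * 1 * ‖S‖ := by gcongr
        _ < ‖S‖ := by nlinarith
    have hpos : 0 < (S * conj T).re := by
      have h3 : (S * conj T).re = ‖S‖ ^ 2 - (S * conj u).re := by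
        rw [hTS, map_sub, mul_sub, Complex.sub_re, Complex.mul_conj', ← Complex.ofReal_pow,
          Complex.ofReal_re]
      have h4 := (Complex.re_le_norm (S * conj u))
      rw [norm_mul, Complex.norm_conj] at h4
      nlinarith
    have hT2 : 0 < (‖T‖ ^ 2)⁻¹ := by positivity
    have hq : S / T = (S * conj T) * ((‖T‖ ^ 2)⁻¹ : ℝ) := by
      have hcT : conj T ≠ 0 := (_root_.map_ne_zero _).2 hT
      push_cast
      rw [← Complex.conj_mul']
      field_simp
    simp only [hq, Complex.re_mul_ofReal]
    positivity
  · simp only [hΦ.eval_zero_revStar, div_one]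

open ENNReal in
theorem lintegral_rnDeriv_rpow_le (hμ : IsNontrivialOnCircle μ) (hΦ : IsMonicOPUC μ Φ) (n : ℕ) :
    ∫⁻ z, (μ.rnDeriv lebCircle z) ^ (1 / 6 : ℝ) ∂lebCircle ≤
      2 * ENNReal.ofReal (1 - ‖verblunsky Φ n‖ ^ 2) ^ (1 / 6 : ℝ) := by
  have := isProbabilityMeasure_lebCircle
  have := hμ.prob
  set D := μ.rnDeriv lebCircle
  have hD : Measurable D := Measure.measurable_rnDeriv _ _
  set S : ℕ → ℂ → ℂ := fun m z => (revStar m (Φ m)).eval z with hS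
  have hSne : ∀ m z, ‖z‖ = 1 → S m z ≠ 0 := fun m z hz => hΦ.eval_revStar_ne_zero hμ hz.le m
  have hSc : ∀ m, Continuous (S m) := fun m => Polynomial.continuous _
  have hSm : ∀ m, Measurable (S m) := fun m => (hSc m).measurable
  have hN := hμ.polyNormSq_pos (hΦ.ne_zero n)
  set N := polyNormSq μ (Φ n)
  have hα : 0 < 1 - ‖verblunsky Φ n‖ ^ 2 := by
    nlinarith [hΦ.norm_verblunsky_lt_one hμ n, norm_nonneg (verblunsky Φ n)]
  let f : Fin 3 → ℂ → ℝ≥0∞ := ![fun z => ENNReal.ofReal (‖S n z / S (n + 1) z‖ ^ (1 / 2 : ℝ)),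
    fun z => ENNReal.ofReal (‖S (n + 1) z‖ ^ 2) * D z,
    fun z => ENNReal.ofReal ((‖S n z‖ ^ 2)⁻¹)]
  let p : Fin 3 → ℝ := ![2 / 3, 1 / 6, 1 / 6]
  have hratio : ∫⁻ z, f 0 z ∂lebCircle ≤ 2 := by
    have hint : Integrable (fun z => ‖S n z / S (n + 1) z‖ ^ (1 / 2 : ℝ)) lebCircle := by
      refine ContinuousOn.integrable_of_circle ae_norm_eq_one_lebCircle ?_
      refine ContinuousOn.rpow_const (ContinuousOn.norm (ContinuousOn.div (hSc n).continuousOn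
        (hSc (n + 1)).continuousOn fun z hz => hSne _ z (mem_sphere_zero_iff_norm.1 hz))) ?_
      exact fun z _ => Or.inr (by norm_num)
    change ∫⁻ z, ENNReal.ofReal (‖S n z / S (n + 1) z‖ ^ (1 / 2 : ℝ)) ∂lebCircle ≤ 2
    rw [← ofReal_integral_eq_lintegral_ofReal hint (Eventually.of_forall fun z => by positivity)]
    exact (ENNReal.ofReal_le_ofReal (hΦ.integral_sqrt_norm_div_le_two hμ n)).trans (by simp)
  have hweight : ∫⁻ z, f 1 z ∂lebCircle ≤
      ENNReal.ofReal (1 - ‖verblunsky Φ n‖ ^ 2) * ENNReal.ofReal N := by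
    change ∫⁻ z, ENNReal.ofReal (‖S (n + 1) z‖ ^ 2) * D z ∂lebCircle ≤ _
    calc ∫⁻ z, ENNReal.ofReal (‖S (n + 1) z‖ ^ 2) * D z ∂lebCircle
        = ∫⁻ z, ENNReal.ofReal (‖S (n + 1) z‖ ^ 2) ∂(lebCircle.withDensity D) := by
          rw [lintegral_withDensity_eq_lintegral_mul _ hD (by fun_prop)]
          simp [mul_comm]
      _ ≤ ∫⁻ z, ENNReal.ofReal (‖S (n + 1) z‖ ^ 2) ∂μ :=
          lintegral_mono' (Measure.withDensity_rnDeriv_le _ _) le_rfl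
      _ = ∫⁻ z, ENNReal.ofReal (‖(Φ (n + 1)).eval z‖ ^ 2) ∂μ := by
          refine lintegral_congr_ae ?_
          filter_upwards [hμ.ae_norm_eq_one] with z hz
          rw [← norm_eval_revStar (hΦ.natDegree_eq _).le hz]
      _ = _ := by
          rw [← ofReal_integral_eq_lintegral_ofReal (hμ.integrable (by fun_prop))
            (Eventually.of_forall fun z => by positivity), ← ENNReal.ofReal_mul hα.le,
            ← hΦ.polyNormSq_succ hμ, polyNormSq]
  have hinv : ∫⁻ z, f 2 z ∂lebCircle = ENNReal.ofReal N⁻¹ := by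
    change ∫⁻ z, ENNReal.ofReal ((‖S n z‖ ^ 2)⁻¹) ∂lebCircle = _
    rw [← ofReal_integral_eq_lintegral_ofReal (hΦ.integrable_inv_sq_norm_revStar hμ n)
      (Eventually.of_forall fun z => by positivity),
      eq_inv_of_mul_eq_one_right (hΦ.polyNormSq_mul_integral_inv_sq_norm hμ n)]
  have hprod : ∀ᵐ z ∂lebCircle, D z ^ (1 / 6 : ℝ) = ∏ i, f i z ^ p i := by
    filter_upwards [ae_norm_eq_one_lebCircle] with z hz
    have hs : 0 < ‖S n z‖ := norm_pos_iff.2 (hSne n z hz)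
    have ht : 0 < ‖S (n + 1) z‖ := norm_pos_iff.2 (hSne (n + 1) z hz)
    have hst : 0 < ‖S n z / S (n + 1) z‖ := by rw [norm_div]; positivity
    simp only [Fin.prod_univ_three, f, p, Matrix.cons_val_zero, Matrix.cons_val_one,
      Matrix.cons_val]
    rw [ENNReal.mul_rpow_of_nonneg _ _ (by norm_num), ENNReal.ofReal_rpow_of_pos (by positivity),
      ENNReal.ofReal_rpow_of_pos (by positivity), ENNReal.ofReal_rpow_of_pos (by positivity)]
    suffices h : (‖S n z / S (n + 1) z‖ ^ (1 / 2 : ℝ)) ^ (2 / 3 : ℝ) *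
        (‖S (n + 1) z‖ ^ 2) ^ (1 / 6 : ℝ) * ((‖S n z‖ ^ 2)⁻¹) ^ (1 / 6 : ℝ) = 1 by
      rw [← mul_assoc, mul_right_comm, ← ENNReal.ofReal_mul (by positivity),
        ← ENNReal.ofReal_mul (by positivity), h, ENNReal.ofReal_one, one_mul]
    rw [← Real.rpow_mul (norm_nonneg _), norm_div, Real.div_rpow hs.le ht.le,
      Real.inv_rpow (by positivity), ← Real.rpow_natCast, ← Real.rpow_natCast,
      ← Real.rpow_mul hs.le, ← Real.rpow_mul ht.le]
    norm_num
    have h1 : ‖S n z‖ ^ (1 / 3 : ℝ) ≠ 0 := by positivity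
    have h2 : ‖S (n + 1) z‖ ^ (1 / 3 : ℝ) ≠ 0 := by positivity
    field_simp
  have hcancel : ENNReal.ofReal N * ENNReal.ofReal N⁻¹ = 1 := by
    rw [← ENNReal.ofReal_mul hN.le, mul_inv_cancel₀ hN.ne', ENNReal.ofReal_one]
  calc ∫⁻ z, D z ^ (1 / 6 : ℝ) ∂lebCircle = ∫⁻ z, ∏ i, f i z ^ p i ∂lebCircle :=
        lintegral_congr_ae hprod
    _ ≤ ∏ i, (∫⁻ z, f i z ∂lebCircle) ^ p i := by
        refine ENNReal.lintegral_prod_norm_pow_le _ (fun i _ => ?_) ?_ fun i _ => ?_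
        · fin_cases i <;>
          · simp only [f]
            exact Measurable.aemeasurable (by dsimp; fun_prop)
        · simp [p, Fin.sum_univ_three]; norm_num
        · fin_cases i <;> norm_num [p]
    _ ≤ 2 ^ (2 / 3 : ℝ) * (ENNReal.ofReal (1 - ‖verblunsky Φ n‖ ^ 2) * ENNReal.ofReal N)
          ^ (1 / 6 : ℝ) * ENNReal.ofReal N⁻¹ ^ (1 / 6 : ℝ) := by
        rw [Fin.prod_univ_three, hinv]
        change _ ^ (2 / 3 : ℝ) * _ ^ (1 / 6 : ℝ) * _ ^ (1 / 6 : ℝ) ≤ _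
        gcongr
    _ = 2 ^ (2 / 3 : ℝ) * ENNReal.ofReal (1 - ‖verblunsky Φ n‖ ^ 2) ^ (1 / 6 : ℝ) := by
        rw [mul_assoc, ← ENNReal.mul_rpow_of_nonneg _ _ (by norm_num), mul_assoc, hcancel, mul_one]
    _ ≤ _ := by
        gcongr
        exact (ENNReal.rpow_le_rpow_of_exponent_le (by norm_num) (by norm_num)).trans_eq
          (ENNReal.rpow_one 2)

end IsMonicOPUC

/-- Rakhmanov's lemma: if `limsup |α_n| = 1` then `μ` is singular with
respect to normalized Lebesgue measure on the unit circle. -/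
theorem stmt15 (μ : Measure ℂ) (hμ : IsNontrivialOnCircle μ)
    (Φ : ℕ → Polynomial ℂ) (hΦ : IsMonicOPUC μ Φ)
    (hlimsup : Filter.limsup (fun n => ‖verblunsky Φ n‖) Filter.atTop = 1) :
    μ.MutuallySingular lebCircle := by
  have := isProbabilityMeasure_lebCircle
  have := hμ.prob
  rw [← Measure.rnDeriv_eq_zero]
  have hD : Measurable (μ.rnDeriv lebCircle) := Measure.measurable_rnDeriv _ _
  have hcont : Tendsto (fun x : ℝ => 2 * ENNReal.ofReal (1 - x ^ 2) ^ (1 / 6 : ℝ))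
      (nhds 1) (nhds 0) := by
    have h1 : Tendsto (fun x : ℝ => ENNReal.ofReal (1 - x ^ 2)) (nhds 1) (nhds 0) := by
      have h : Continuous fun x : ℝ => ENNReal.ofReal (1 - x ^ 2) :=
        ENNReal.continuous_ofReal.comp (by fun_prop)
      simpa using h.tendsto 1
    have h2 := ENNReal.Tendsto.const_mul (a := 2) (h1.ennrpow_const (1 / 6 : ℝ))
      (Or.inr (by norm_num))
    simpa using h2
  have hzero : ∫⁻ z, (μ.rnDeriv lebCircle z) ^ (1 / 6 : ℝ) ∂lebCircle = 0 := by
    refine le_antisymm (le_of_forall_gt fun ε hε => ?_) bot_le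
    obtain ⟨δ, hδ, hball⟩ := Metric.eventually_nhds_iff.1 (hcont.eventually_lt_const hε)
    have hcob : IsCoboundedUnder (· ≤ ·) atTop fun n => ‖verblunsky Φ n‖ :=
      IsBoundedUnder.isCoboundedUnder_le ⟨0, eventually_map.2 (Eventually.of_forall fun n =>
        norm_nonneg (verblunsky Φ n))⟩
    obtain ⟨n, hn⟩ := (frequently_lt_of_lt_limsup hcob
      (hlimsup.symm ▸ sub_lt_self 1 hδ : 1 - δ < _)).exists
    refine (hΦ.lintegral_rnDeriv_rpow_le hμ n).trans_lt (hball ?_)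
    have hlt := hΦ.norm_verblunsky_lt_one hμ n
    rw [Real.dist_eq, abs_lt]
    constructor <;> linarith
  rw [lintegral_eq_zero_iff (hD.pow_const _)] at hzero
  filter_upwards [hzero] with z hz
  exact (ENNReal.rpow_eq_zero_iff_of_pos (by norm_num)).1 hz

end
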